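/- Fix a nonnegative integer d and complex parameters ρ, σ such that ρ + m ≠ 0 for all integers 1 ≤ m ≤ d + 1 and ρ − σ − m ≠ 0 for all integers 0 ≤ m ≤ d + 1. Then for all integers 0 ≤ x ≤ d and 0 ≤ i ≤ d, the following contiguity relation for the normalized dual Hahn functions holds: ((x − d − 1)(x + d + σ + 2)/(d − ρ + σ + 1)) · p_{x,i}(d; ρ, σ) = (i − d − 1) · p_{x,i}(d+1; ρ, σ) − (i + 1) · p_{x,i+1}(d+1; ρ, σ). -/

import Mathlib

/-- Pochhammer symbol `(a)_k = a (a+1) ⋯ (a+k-1)`. -/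
noncomputable def poch (a : ℂ) (k : ℕ) : ℂ := ∏ l ∈ Finset.range k, (a + l)

/-- Normalized dual Hahn function `p_{x,i}(d; ρ, σ)`, with the convention that it
vanishes for negative `i`. -/
noncomputable def dualHahnP (d : ℕ) (ρ σ : ℂ) (x : ℕ) (i : ℤ) : ℂ :=
  if i < 0 then 0
  else
    (-1 : ℂ) ^ i.toNat * (d.choose i.toNat : ℂ) * poch (ρ + 1) i.toNat /
        poch (ρ - σ - (d : ℂ)) i.toNat *
      ∑ k ∈ Finset.range (min i.toNat x + 1),
        poch (-(i.toNat : ℂ)) k * poch (-(x : ℂ)) k * poch ((x : ℂ) + 1 + σ) k /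
          (poch (ρ + 1) k * poch (-(d : ℂ)) k * (k.factorial : ℂ))

theorem poch_succ (a : ℂ) (k : ℕ) : poch a (k + 1) = poch a k * (a + k) :=
  Finset.prod_range_succ _ _

theorem poch_succ_left (a : ℂ) (k : ℕ) : poch a (k + 1) = a * poch (a + 1) k := by
  unfold poch
  rw [Finset.prod_range_succ', mul_comm]
  congr 1
  · simp
  · refine Finset.prod_congr rfl fun l _ => ?_
    push_cast
    ring

theorem poch_neg_natCast_eq_zero {n k : ℕ} (h : n < k) : poch (-(n : ℂ)) k = 0 :=
  Finset.prod_eq_zero (Finset.mem_range.2 h) (by simp)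

theorem poch_neg_natCast_ne_zero {n k : ℕ} (h : k ≤ n) : poch (-(n : ℂ)) k ≠ 0 := by
  refine Finset.prod_ne_zero_iff.2 fun l hl h0 => ?_
  have : (l : ℂ) = n := by linear_combination h0
  have := Nat.cast_injective this
  have := Finset.mem_range.1 hl
  omega

/-- The `k`-th term of the hypergeometric sum defining the dual Hahn function. -/
noncomputable def dualHahnTerm (d : ℕ) (ρ σ : ℂ) (x i k : ℕ) : ℂ :=
  poch (-(i : ℂ)) k * poch (-(x : ℂ)) k * poch ((x : ℂ) + 1 + σ) k /
    (poch (ρ + 1) k * poch (-(d : ℂ)) k * (k.factorial : ℂ))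

theorem dualHahnP_natCast (d : ℕ) (ρ σ : ℂ) (x i : ℕ) :
    dualHahnP d ρ σ x (i : ℤ) =
      (-1 : ℂ) ^ i * (d.choose i : ℂ) * poch (ρ + 1) i / poch (ρ - σ - (d : ℂ)) i *
        ∑ k ∈ Finset.range (x + 1), dualHahnTerm d ρ σ x i k := by
  have h : ¬ ((i : ℤ) < 0) := by omega
  simp only [dualHahnP, if_neg h, Int.toNat_natCast]
  congr 1
  refine Finset.sum_subset (Finset.range_mono (by omega)) fun k hk hk' => ?_
  simp only [Finset.mem_range] at hk hk'
  rw [poch_neg_natCast_eq_zero (show i < k by omega)]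
  simp

/-- Telescoped form of the contiguity relation between the hypergeometric partial sums. -/
theorem sum_dualHahnTerm_contiguity (d : ℕ) (ρ σ : ℂ) (x i n : ℕ) (hn : n ≤ d)
    (hρ : ∀ m : ℕ, 1 ≤ m → m ≤ d + 1 → ρ + (m : ℂ) ≠ 0) :
    ((x : ℂ) - d - 1) * ((x : ℂ) + d + σ + 2) *
        ∑ k ∈ Finset.range (n + 1), dualHahnTerm d ρ σ x i k =
      ((d : ℂ) + 1) * (ρ - σ - d - 1 + i) *
          ∑ k ∈ Finset.range (n + 1), dualHahnTerm (d + 1) ρ σ x i k -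
        ((d : ℂ) + 1) * (ρ + 1 + i) *
          ∑ k ∈ Finset.range (n + 1), dualHahnTerm (d + 1) ρ σ x (i + 1) k -
        poch (-(i : ℂ)) n * poch (-(x : ℂ)) (n + 1) * poch ((x : ℂ) + 1 + σ) (n + 1) /
          (poch (ρ + 1) n * poch (-(d : ℂ)) n * (n.factorial : ℂ)) := by
  induction n with
  | zero =>
    simp [dualHahnTerm, poch]
    ring
  | succ n ih =>
    have ih := ih (by omega)
    rw [Finset.sum_range_succ _ (n + 1), Finset.sum_range_succ _ (n + 1),
      Finset.sum_range_succ _ (n + 1), mul_add _ (Finset.sum _ _), mul_add _ (Finset.sum _ _),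
      mul_add _ (Finset.sum _ _), ih]
    have hf : (n.factorial : ℂ) ≠ 0 := Nat.cast_ne_zero.2 n.factorial_ne_zero
    have hn1 : (n : ℂ) + 1 ≠ 0 := Nat.cast_add_one_ne_zero n
    have hd1 : (d : ℂ) + 1 ≠ 0 := Nat.cast_add_one_ne_zero d
    have hP : poch (ρ + 1) n ≠ 0 := by
      refine Finset.prod_ne_zero_iff.2 fun l hl => ?_
      have hl := Finset.mem_range.1 hl
      have := hρ (l + 1) (by omega) (by omega)
      push_cast at this
      rwa [add_assoc, add_comm 1]
    have hρn : ρ + 1 + n ≠ 0 := by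
      have := hρ (n + 1) (by omega) (by omega)
      push_cast at this
      rwa [add_assoc, add_comm 1]
    have hD : poch (-(d : ℂ)) n ≠ 0 := poch_neg_natCast_ne_zero (by omega)
    have hDn : -(d : ℂ) + n ≠ 0 := by
      have h := poch_neg_natCast_ne_zero hn
      rw [poch_succ] at h
      exact right_ne_zero_of_mul h
    have shift (m : ℕ) : poch (-((m + 1 : ℕ) : ℂ)) (n + 1) =
        -((m : ℂ) + 1) * poch (-(m : ℂ)) n := by
      rw [poch_succ_left]
      push_cast
      congr 2
      ring
    simp only [dualHahnTerm, shift, Nat.factorial_succ, poch_succ _ (n + 1)]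
    simp only [poch_succ _ n]
    push_cast
    generalize poch (-(d : ℂ)) n = D at *
    generalize poch (ρ + 1) n = P at *
    generalize (n.factorial : ℂ) = f at *
    generalize poch (-(i : ℂ)) n = I at *
    generalize poch (-(x : ℂ)) n = X at *
    generalize poch ((x : ℂ) + 1 + σ) n = Y at *
    clear ih
    field_simp
    ring

theorem dualHahn_contiguity_raise (d : ℕ) (ρ σ : ℂ)
    (hρ : ∀ m : ℕ, 1 ≤ m → m ≤ d + 1 → ρ + (m : ℂ) ≠ 0)
    (hρσ : ∀ m : ℕ, m ≤ d + 1 → ρ - σ - (m : ℂ) ≠ 0)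
    (x i : ℕ) (hx : x ≤ d) (hi : i ≤ d) :
    ((x : ℂ) - d - 1) * ((x : ℂ) + d + σ + 2) / ((d : ℂ) - ρ + σ + 1) *
        dualHahnP d ρ σ x (i : ℤ) =
      ((i : ℂ) - d - 1) * dualHahnP (d + 1) ρ σ x (i : ℤ) -
        ((i : ℂ) + 1) * dualHahnP (d + 1) ρ σ x ((i : ℤ) + 1) := by
  have hx' := sum_dualHahnTerm_contiguity d ρ σ x i x hx hρ
  rw [poch_neg_natCast_eq_zero (Nat.lt_succ_self x), mul_zero, zero_mul, zero_div,
    sub_zero] at hx'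
  rw [show (i : ℤ) + 1 = ((i + 1 : ℕ) : ℤ) by push_cast; rfl]
  simp only [dualHahnP_natCast]
  set S := ∑ k ∈ Finset.range (x + 1), dualHahnTerm d ρ σ x i k
  set T := ∑ k ∈ Finset.range (x + 1), dualHahnTerm (d + 1) ρ σ x i k
  set U := ∑ k ∈ Finset.range (x + 1), dualHahnTerm (d + 1) ρ σ x (i + 1) k
  have hB : poch (ρ - σ - d) i ≠ 0 := by
    refine Finset.prod_ne_zero_iff.2 fun l hl => ?_
    have hl := Finset.mem_range.1 hl
    have := hρσ (d - l) (by omega)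
    rw [Nat.cast_sub (by omega)] at this
    convert this using 1
    ring
  have hE : ρ - σ - d - 1 ≠ 0 := by
    convert hρσ (d + 1) le_rfl using 1
    push_cast
    ring
  have hEi : ρ - σ - d - 1 + i ≠ 0 := by
    convert hρσ (d + 1 - i) (by omega) using 1
    rw [Nat.cast_sub (by omega)]
    push_cast
    ring
  have hE' : (d : ℂ) - ρ + σ + 1 = -(ρ - σ - d - 1) := by ring
  have hB1 : poch (ρ - σ - ((d + 1 : ℕ) : ℂ)) (i + 1) =
      (ρ - σ - d - 1) * poch (ρ - σ - d) i := by
    rw [poch_succ_left, Nat.cast_add_one, show ρ - σ - ((d : ℂ) + 1) + 1 = ρ - σ - d by ring]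
    ring
  have hB0 : poch (ρ - σ - ((d + 1 : ℕ) : ℂ)) i =
      (ρ - σ - d - 1) * poch (ρ - σ - d) i / (ρ - σ - d - 1 + i) := by
    rw [eq_div_iff hEi, ← hB1, poch_succ]
    push_cast
    ring
  have hi1 : (i : ℂ) + 1 ≠ 0 := Nat.cast_add_one_ne_zero i
  have hdi : (d : ℂ) + 1 - i ≠ 0 := by
    rw [← Nat.cast_add_one, ← Nat.cast_sub (by omega)]
    exact Nat.cast_ne_zero.2 (by omega)
  have hC1 : ((d + 1).choose (i + 1) : ℂ) = (d + 1) * d.choose i / (i + 1) := by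
    rw [eq_div_iff hi1]
    exact_mod_cast (Nat.add_one_mul_choose_eq d i).symm
  have hC0 : ((d + 1).choose i : ℂ) = (d + 1) * d.choose i / (d + 1 - i) := by
    rw [eq_div_iff hdi, ← Nat.cast_add_one, ← Nat.cast_sub (by omega)]
    exact_mod_cast (Nat.choose_mul_succ_eq d i).symm.trans (mul_comm _ _)
  rw [hB1, hB0, hC1, hC0, hE', poch_succ (ρ + 1) i, pow_succ]
  have hL : ((x : ℂ) - d - 1) * ((x : ℂ) + d + σ + 2) / -(ρ - σ - d - 1) *
      ((-1) ^ i * (d.choose i : ℂ) * poch (ρ + 1) i / poch (ρ - σ - d) i * S) =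
      -((-1) ^ i * (d.choose i : ℂ) * poch (ρ + 1) i /
        (poch (ρ - σ - d) i * (ρ - σ - d - 1))) *
        (((x : ℂ) - d - 1) * ((x : ℂ) + d + σ + 2) * S) := by
    rw [div_neg]
    field_simp
  rw [hL, hx', show (i : ℂ) - d - 1 = -((d : ℂ) + 1 - i) by ring]
  generalize (d : ℂ) + 1 - i = w at *
  generalize ρ - σ - d - 1 + i = v at *
  generalize ρ - σ - d - 1 = u at *
  field_simp
  ring
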